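/- Let r>0 and let E(r) ⊂ ℝ³ be the union of the 36 closed segments: the 12 segments joining A^a=(a,0,0), B^b=(0,b,0), C^c=(0,0,c) pairwise (for all sign choices a,b,c∈{+1,-1} giving segments A^aB^b, A^aC^c, B^bC^c), and the 24 segments joining each apex D^{abc}=(ar/3,br/3,cr/3) to A^a, to B^b, and to C^c. Let μ be the 1-dimensional Hausdorff measure restricted to E(r). Let r₁ be the unique positive real root of χ₁(r) = 16r⁸+32r⁷+40r⁶-48r⁵-396r⁴-432r³-810r²-972r-729. A continuous function f:ℝ³→ℝ satisfies f(x) = (1/μ(E(r)))·∫_{E(r)} f(x+s·y) dμ(y) for all x∈ℝ³ and all s>0 if and only if: (when r=r₁) f coincides with the function of a polynomial p∈ℝ[x₁,x₂,x₃] satisfying e₂(∂)p = e₆(∂)p = e₄(∂)²p = 0; and (when r≠r₁) f coincides with the function of a polynomial p satisfying e₂(∂)p = e₄(∂)p = e₆(∂)p = 0. -/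

import Mathlib

open MvPolynomial MeasureTheory

noncomputable def dop (φ : MvPolynomial (Fin 3) ℝ) :
    MvPolynomial (Fin 3) ℝ →ₗ[ℝ] MvPolynomial (Fin 3) ℝ :=
  φ.support.sum fun s => φ.coeff s •
    (((pderiv (0 : Fin 3)).toLinearMap ^ s 0) *
     ((pderiv (1 : Fin 3)).toLinearMap ^ s 1) *
     ((pderiv (2 : Fin 3)).toLinearMap ^ s 2))

noncomputable def e2 : MvPolynomial (Fin 3) ℝ := X 0 ^ 2 + X 1 ^ 2 + X 2 ^ 2
noncomputable def e4 : MvPolynomial (Fin 3) ℝ :=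
  X 1 ^ 2 * X 2 ^ 2 + X 2 ^ 2 * X 0 ^ 2 + X 0 ^ 2 * X 1 ^ 2
noncomputable def e6 : MvPolynomial (Fin 3) ℝ := X 0 ^ 2 * X 1 ^ 2 * X 2 ^ 2

noncomputable abbrev E3 := EuclideanSpace ℝ (Fin 3)

noncomputable def toFn (x : E3) : Fin 3 → ℝ := (WithLp.equiv 2 (Fin 3 → ℝ)) x

noncomputable def pt (u : Fin 3 → ℝ) : E3 := (WithLp.equiv 2 (Fin 3 → ℝ)).symm u

/-- A sign `±1` attached to a boolean. -/
def sg (b : Bool) : ℝ := if b then 1 else -1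

/-- Vertices of the regular octahedron. -/
noncomputable def vA (a : Bool) : E3 := pt ![sg a, 0, 0]
noncomputable def vB (b : Bool) : E3 := pt ![0, sg b, 0]
noncomputable def vC (c : Bool) : E3 := pt ![0, 0, sg c]

/-- Apex vertices of the isohedral triakis octahedron with parameter `r`. -/
noncomputable def vD (r : ℝ) (a b c : Bool) : E3 :=
  pt ![sg a * r / 3, sg b * r / 3, sg c * r / 3]

/-- The 1-skeleton (union of the 36 edges) of the isohedral triakis octahedron
with parameter `r`. -/
noncomputable def edgeSet (r : ℝ) : Set E3 :=
  (⋃ (a : Bool) (b : Bool), segment ℝ (vA a) (vB b)) ∪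
  (⋃ (a : Bool) (c : Bool), segment ℝ (vA a) (vC c)) ∪
  (⋃ (b : Bool) (c : Bool), segment ℝ (vB b) (vC c)) ∪
  (⋃ (a : Bool) (b : Bool) (c : Bool),
    segment ℝ (vA a) (vD r a b c) ∪ segment ℝ (vB b) (vD r a b c) ∪
    segment ℝ (vC c) (vD r a b c))

section Operators

variable {V W : Type*} [AddCommGroup V] [Module ℝ V] [AddCommGroup W] [Module ℝ W]

/-- The monoid homomorphism sending a multi-index to the corresponding product of powers of three
commuting endomorphisms. -/
noncomputable def monomialOp (D : Fin 3 → Module.End ℝ V) (h : ∀ i j, Commute (D i) (D j)) :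
    Multiplicative (Fin 3 →₀ ℕ) →* Module.End ℝ V where
  toFun s := D 0 ^ (s.toAdd 0) * D 1 ^ (s.toAdd 1) * D 2 ^ (s.toAdd 2)
  map_one' := by simp
  map_mul' s t := by
    simp only [toAdd_mul, Finsupp.add_apply, pow_add]
    have h1 : Commute (D 0 ^ t.toAdd 0) (D 1 ^ s.toAdd 1) := (h 0 1).pow_pow _ _
    have h2 : Commute (D 0 ^ t.toAdd 0 * D 1 ^ t.toAdd 1) (D 2 ^ s.toAdd 2) :=
      ((h 0 2).pow_pow _ _).mul_left ((h 1 2).pow_pow _ _)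
    rw [h1.mul_mul_mul_comm, h2.mul_mul_mul_comm]

/-- The action of polynomials through three commuting endomorphisms. -/
noncomputable def act (D : Fin 3 → Module.End ℝ V) (h : ∀ i j, Commute (D i) (D j)) :
    MvPolynomial (Fin 3) ℝ →ₐ[ℝ] Module.End ℝ V :=
  AddMonoidAlgebra.lift ℝ _ _ (monomialOp D h)

theorem act_eq_sum (D : Fin 3 → Module.End ℝ V) (h : ∀ i j, Commute (D i) (D j))
    (φ : MvPolynomial (Fin 3) ℝ) :
    act D h φ = φ.support.sum fun s => φ.coeff s • (D 0 ^ s 0 * D 1 ^ s 1 * D 2 ^ s 2) := by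
  rw [act, AddMonoidAlgebra.lift_apply]
  rfl

theorem act_X (D : Fin 3 → Module.End ℝ V) (h : ∀ i j, Commute (D i) (D j)) (i : Fin 3) :
    act D h (X i) = D i := by
  rw [act_eq_sum, support_X, Finset.sum_singleton, coeff_X_same, one_smul]
  fin_cases i <;> simp

theorem map_act {D : Fin 3 → Module.End ℝ V} (h : ∀ i j, Commute (D i) (D j))
    {D' : Fin 3 → Module.End ℝ W} (h' : ∀ i j, Commute (D' i) (D' j)) (T : V →ₗ[ℝ] W)
    (hT : ∀ i v, T (D i v) = D' i (T v)) (φ : MvPolynomial (Fin 3) ℝ) (v : V) :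
    T (act D h φ v) = act D' h' φ (T v) := by
  induction φ using MvPolynomial.induction_on generalizing v with
  | C a => simp [← MvPolynomial.algebraMap_eq, Module.algebraMap_end_apply]
  | add p q hp hq => simp [hp, hq]
  | mul_X p i hp => simp [map_mul, hp, act_X, hT]

/-- The polynomials whose action annihilates a given vector. -/
noncomputable def annIdeal (D : Fin 3 → Module.End ℝ V) (h : ∀ i j, Commute (D i) (D j)) (v : V) :
    Ideal (MvPolynomial (Fin 3) ℝ) where
  carrier := {φ | act D h φ v = 0}
  add_mem' := by
    intro a b ha hb
    simp only [Set.mem_ofPred_eq] at *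
    simp [ha, hb]
  zero_mem' := by simp
  smul_mem' := by
    intro c a ha
    simp only [Set.mem_ofPred_eq] at *
    simp [ha]

theorem mem_annIdeal {D : Fin 3 → Module.End ℝ V} {h : ∀ i j, Commute (D i) (D j)} {v : V}
    {φ : MvPolynomial (Fin 3) ℝ} : φ ∈ annIdeal D h v ↔ act D h φ v = 0 := Iff.rfl

end Operators

theorem pderiv_commute (i j : Fin 3) :
    Commute (S := Module.End ℝ (MvPolynomial (Fin 3) ℝ)) (pderiv i).toLinearMap
      (pderiv j).toLinearMap := by
  have h : ⁅(pderiv i : Derivation ℝ (MvPolynomial (Fin 3) ℝ) (MvPolynomial (Fin 3) ℝ)),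
      (pderiv j : Derivation ℝ (MvPolynomial (Fin 3) ℝ) (MvPolynomial (Fin 3) ℝ))⁆ = 0 := by
    apply MvPolynomial.derivation_ext
    intro k
    rw [Derivation.commutator_apply]
    simp only [pderiv_X, Pi.single_apply]
    split_ifs <;> simp
  refine LinearMap.ext fun p => ?_
  have := congrArg (fun d => d p) h
  simpa [Derivation.commutator_apply, sub_eq_zero] using this

theorem dop_eq_act (φ : MvPolynomial (Fin 3) ℝ) :
    dop φ = act (fun i => (pderiv i).toLinearMap) pderiv_commute φ := by
  rw [act_eq_sum, dop]

section Smooth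

open scoped ContDiff

/-- The space of smooth real functions on `ℝ³`. -/
def smoothFn : Submodule ℝ (E3 → ℝ) where
  carrier := {g | ContDiff ℝ ∞ g}
  add_mem' {a b} ha hb := by
    simp only [Set.mem_ofPred_eq] at *
    exact ha.add hb
  zero_mem' := by
    simp only [Set.mem_ofPred_eq]
    exact contDiff_const
  smul_mem' c a ha := by
    simp only [Set.mem_ofPred_eq] at *
    exact contDiff_const.smul ha

theorem contDiff_smoothFn (g : smoothFn) : ContDiff ℝ ∞ g.1 := g.2

theorem differentiable_smoothFn (g : smoothFn) : Differentiable ℝ g.1 :=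
  (contDiff_smoothFn g).differentiable (by simp)

/-- The `i`-th partial derivative on smooth functions. -/
noncomputable def partialD (i : Fin 3) : Module.End ℝ smoothFn where
  toFun g := ⟨fun x => fderiv ℝ g.1 x (EuclideanSpace.single i 1),
    ((contDiff_smoothFn g).fderiv_right (m := ∞) (by simp)).clm_apply contDiff_const⟩
  map_add' g h := by
    ext x
    simp [fderiv_add (differentiable_smoothFn g x) (differentiable_smoothFn h x)]
  map_smul' c g := by
    ext x
    simp [fderiv_const_smul (differentiable_smoothFn g x)]

theorem partialD_apply (i : Fin 3) (g : smoothFn) (x : E3) :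
    (partialD i g).1 x = fderiv ℝ g.1 x (EuclideanSpace.single i 1) := rfl

theorem partialD_commute (i j : Fin 3) : Commute (partialD i) (partialD j) := by
  have key : ∀ (i j : Fin 3) (g : smoothFn) (x : E3), (partialD i (partialD j g)).1 x =
      fderiv ℝ (fderiv ℝ g.1) x (EuclideanSpace.single i 1) (EuclideanSpace.single j 1) := by
    intro i j g x
    have hd : DifferentiableAt ℝ (fderiv ℝ g.1) x :=
      ((contDiff_smoothFn g).fderiv_right (m := ∞) (by simp)).differentiable (by simp) x
    rw [partialD_apply]
    change fderiv ℝ (fun x => fderiv ℝ g.1 x (EuclideanSpace.single j 1)) x _ = _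
    rw [fderiv_clm_apply hd (differentiableAt_const _)]
    simp
  refine LinearMap.ext fun g => Subtype.ext (funext fun x => ?_)
  change (partialD i (partialD j g)).1 x = (partialD j (partialD i g)).1 x
  rw [key, key]
  exact ((contDiff_infty.1 (contDiff_smoothFn g) 2).contDiffAt.isSymmSndFDerivAt (by simp)) _ _

theorem fderiv_eq_sum_partialD (g : smoothFn) (x y : E3) :
    fderiv ℝ g.1 x y = ∑ i, y i * (partialD i g).1 x := by
  conv_lhs => rw [← (EuclideanSpace.basisFun (Fin 3) ℝ).sum_repr y]
  simp [partialD_apply]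

/-- The action of polynomials on smooth functions as differential operators. -/
noncomputable abbrev diffOp : MvPolynomial (Fin 3) ℝ →ₐ[ℝ] Module.End ℝ smoothFn :=
  act partialD partialD_commute

/-- The coordinate functionals on `ℝ³`. -/
noncomputable abbrev coordL (i : Fin 3) : E3 →L[ℝ] ℝ := EuclideanSpace.proj i

theorem hasFDerivAt_eval (p : MvPolynomial (Fin 3) ℝ) (x : E3) :
    HasFDerivAt (fun x : E3 => eval (toFn x) p)
      (∑ i, eval (toFn x) (pderiv i p) • coordL i) x := by
  induction p using MvPolynomial.induction_on with
  | C a => simpa using hasFDerivAt_const a x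
  | add p q hp hq =>
    simp only [map_add, add_smul, Finset.sum_add_distrib]
    exact hp.add hq
  | mul_X p i hp =>
    have h2 : HasFDerivAt (fun x : E3 => x i)
        (coordL i) x :=
      (coordL i).hasFDerivAt
    have h := hp.mul h2
    simp only [map_mul, eval_X]
    refine h.congr_fderiv ?_
    ext y
    simp only [pderiv_mul, pderiv_X, toFn]
    fin_cases i <;> simp [Fin.sum_univ_three, Pi.single_apply] <;> ring

theorem contDiff_eval (p : MvPolynomial (Fin 3) ℝ) :
    ContDiff ℝ ∞ (fun x : E3 => eval (toFn x) p) := by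
  induction p using MvPolynomial.induction_on with
  | C a => simpa using contDiff_const
  | add p q hp hq => simpa using hp.add hq
  | mul_X p i hp =>
    simp only [map_mul, eval_X]
    exact hp.mul (coordL i).contDiff

/-- Polynomials as smooth functions. -/
noncomputable def evalSmooth : MvPolynomial (Fin 3) ℝ →ₗ[ℝ] smoothFn where
  toFun p := ⟨fun x => eval (toFn x) p, contDiff_eval p⟩
  map_add' p q := by ext x; simp
  map_smul' c p := by ext x; simp

theorem evalSmooth_apply (p : MvPolynomial (Fin 3) ℝ) (x : E3) :
    (evalSmooth p).1 x = eval (toFn x) p := rfl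

theorem evalSmooth_injective : Function.Injective evalSmooth := by
  intro p q h
  apply MvPolynomial.funext
  intro x
  have := congrFun (congrArg Subtype.val h) (pt x)
  simpa [evalSmooth_apply, toFn, pt] using this

theorem evalSmooth_dop (φ p : MvPolynomial (Fin 3) ℝ) :
    evalSmooth (dop φ p) = diffOp φ (evalSmooth p) := by
  rw [dop_eq_act]
  refine map_act pderiv_commute partialD_commute evalSmooth (fun i q => ?_) φ p
  refine Subtype.ext (funext fun x => ?_)
  rw [partialD_apply]
  have h := (hasFDerivAt_eval q x).fderiv
  change _ = fderiv ℝ (fun x : E3 => eval (toFn x) q) x _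
  rw [h]
  simp [evalSmooth_apply, PiLp.single_apply]

theorem dop_eq_zero_iff (φ p : MvPolynomial (Fin 3) ℝ) :
    dop φ p = 0 ↔ φ ∈ annIdeal partialD partialD_commute (evalSmooth p) := by
  rw [mem_annIdeal, ← evalSmooth_dop, ← evalSmooth.map_zero, evalSmooth_injective.eq_iff]

end Smooth
section Directional

/-- The linear form with coefficient vector `y`. -/
noncomputable def linForm (y : E3) : MvPolynomial (Fin 3) ℝ := ∑ i, C (y i) * X i

theorem diffOp_C_mul (c : ℝ) (φ : MvPolynomial (Fin 3) ℝ) (g : smoothFn) :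
    diffOp (C c * φ) g = c • diffOp φ g := by
  rw [← smul_eq_C_mul, map_smul, LinearMap.smul_apply]

theorem diffOp_linForm (y : E3) (g : smoothFn) :
    diffOp (linForm y) g = ∑ i, y i • partialD i g := by
  simp only [linForm, map_sum, LinearMap.sum_apply, diffOp_C_mul, diffOp, act_X]

theorem diffOp_linForm_apply (y : E3) (g : smoothFn) (x : E3) :
    (diffOp (linForm y) g).1 x = fderiv ℝ g.1 x y := by
  rw [diffOp_linForm, fderiv_eq_sum_partialD]
  simp [Finset.sum_apply]

theorem linForm_pow (y : E3) (k : ℕ) :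
    linForm y ^ k = ∑ m ∈ Finset.piAntidiag (Finset.univ : Finset (Fin 3)) k,
      C (Nat.multinomial Finset.univ m * ∏ i, y i ^ m i) * ∏ i, X i ^ m i := by
  rw [linForm, Finset.sum_pow_eq_sum_piAntidiag]
  refine Finset.sum_congr rfl fun m _ => ?_
  simp only [mul_pow, Finset.prod_mul_distrib, C_mul, map_prod, map_pow, map_natCast]
  ring

theorem continuous_diffOp_linForm_pow (k : ℕ) (g : smoothFn) :
    Continuous fun q : E3 × E3 => (diffOp (linForm q.1 ^ k) g).1 q.2 := by
  induction k generalizing g with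
  | zero =>
    simp only [pow_zero, map_one, Module.End.one_apply]
    exact (contDiff_smoothFn g).continuous.comp continuous_snd
  | succ k ih =>
    have h : (fun q : E3 × E3 => (diffOp (linForm q.1 ^ (k + 1)) g).1 q.2) =
        fun q => ∑ i, q.1 i * (diffOp (linForm q.1 ^ k) (partialD i g)).1 q.2 := by
      funext q
      rw [pow_succ, map_mul, Module.End.mul_apply, diffOp_linForm]
      simp [Finset.sum_apply]
    rw [h]
    refine continuous_finsetSum _ fun i _ => Continuous.mul ?_ (ih _)
    exact (coordL i).continuous.comp continuous_fst

theorem hasDerivAt_diffOp_linForm_pow (k : ℕ) (g : smoothFn) (x y : E3) (s : ℝ) :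
    HasDerivAt (fun s : ℝ => (diffOp (linForm y ^ k) g).1 (x + s • y))
      ((diffOp (linForm y ^ (k + 1)) g).1 (x + s • y)) s := by
  rw [pow_succ', map_mul, Module.End.mul_apply, diffOp_linForm_apply]
  have h1 : HasDerivAt (fun s : ℝ => x + s • y) y s := by
    simpa using ((hasDerivAt_id s).smul_const y).const_add x
  exact (differentiable_smoothFn _ _).hasFDerivAt.comp_hasDerivAt s h1

theorem eq_taylor_sum (N : ℕ) (G : ℕ → ℝ → ℝ) (hG : ∀ k t, HasDerivAt (G k) (G (k + 1) t) t)
    (hN : ∀ t, G N t = 0) (t : ℝ) :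
    G 0 t = ∑ k ∈ Finset.range N, t ^ k / (k.factorial : ℝ) * G k 0 := by
  induction N generalizing G t with
  | zero => simpa using hN t
  | succ N ih =>
    have h1 := ih (fun k => G (k + 1)) (fun k t => hG (k + 1) t) hN
    have hd : ∀ t, HasDerivAt (fun t => G 0 t -
        ∑ k ∈ Finset.range N, t ^ (k + 1) / ((k + 1).factorial : ℝ) * G (k + 1) 0) 0 t := by
      intro t
      have h2 : HasDerivAt (fun t : ℝ =>
          ∑ k ∈ Finset.range N, t ^ (k + 1) / ((k + 1).factorial : ℝ) * G (k + 1) 0)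
          (∑ k ∈ Finset.range N, t ^ k / (k.factorial : ℝ) * G (k + 1) 0) t := by
        refine HasDerivAt.fun_sum fun k _ => ?_
        have h3 := ((hasDerivAt_pow (k + 1) t).div_const ((k + 1).factorial : ℝ)).mul_const
          (G (k + 1) 0)
        refine h3.congr_deriv ?_
        rw [Nat.factorial_succ]
        have : (k.factorial : ℝ) ≠ 0 := by positivity
        have : (k : ℝ) + 1 ≠ 0 := by positivity
        push_cast
        field_simp
      have h4 := (hG 0 t).sub h2
      rwa [zero_add, h1 t, sub_self] at h4
    have hc := is_const_of_deriv_eq_zero (fun t => (hd t).differentiableAt)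
      (fun t => (hd t).deriv) t 0
    simp only [ne_eq, Nat.add_eq_zero_iff, one_ne_zero, and_false, not_false_eq_true, zero_pow,
      zero_div, zero_mul, Finset.sum_const_zero, sub_zero] at hc
    rw [Finset.sum_range_succ']
    simp only [pow_zero, Nat.factorial_zero, Nat.cast_one, div_one, one_mul]
    linarith

/-- The space of polynomial functions of degree less than `N`. -/
noncomputable def polyFn (N : ℕ) : Submodule ℝ (E3 → ℝ) :=
  Submodule.span ℝ ((fun m : Fin 3 → ℕ => fun x : E3 => ∏ i, x i ^ m i) ''
    ((Finset.range N).biUnion fun k => Finset.piAntidiag Finset.univ k : Finset (Fin 3 → ℕ)))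

theorem isClosed_polyFn (N : ℕ) : IsClosed (polyFn N : Set (E3 → ℝ)) := by
  have : FiniteDimensional ℝ (polyFn N) :=
    FiniteDimensional.span_of_finite ℝ ((Finset.finite_toSet _).image _)
  exact Submodule.closed_of_finiteDimensional _

theorem exists_eval_of_mem_polyFn {N : ℕ} {f : E3 → ℝ} (hf : f ∈ polyFn N) :
    ∃ p : MvPolynomial (Fin 3) ℝ, ∀ x, f x = eval (toFn x) p := by
  have hle : polyFn N ≤ LinearMap.range (smoothFn.subtype ∘ₗ evalSmooth) := by
    refine Submodule.span_le.2 ?_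
    rintro _ ⟨m, -, rfl⟩
    refine ⟨∏ i, X i ^ m i, ?_⟩
    funext x
    simp [evalSmooth_apply, toFn]
  obtain ⟨p, rfl⟩ := hle hf
  exact ⟨p, fun x => rfl⟩

theorem mem_polyFn_of_diffOp_eq_zero {N : ℕ} {g : smoothFn}
    (hg : ∀ y, diffOp (linForm y ^ N) g = 0) : g.1 ∈ polyFn N := by
  have h : g.1 = ∑ k ∈ Finset.range N, ∑ m ∈ Finset.piAntidiag (Finset.univ : Finset (Fin 3)) k,
      (((k.factorial : ℝ)⁻¹ * Nat.multinomial Finset.univ m) *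
        (diffOp (∏ i, X i ^ m i) g).1 0) • fun x : E3 => ∏ i, x i ^ m i := by
    funext x
    have h1 := eq_taylor_sum N (fun k t => (diffOp (linForm x ^ k) g).1 (0 + t • x))
      (fun k t => hasDerivAt_diffOp_linForm_pow k g 0 x t) (fun t => by rw [hg x]; rfl) 1
    simp only [pow_zero, map_one, Module.End.one_apply, zero_add, one_smul, one_pow,
      zero_smul] at h1
    rw [h1, Finset.sum_apply]
    refine Finset.sum_congr rfl fun k _ => ?_
    rw [linForm_pow, map_sum, LinearMap.sum_apply]
    simp only [diffOp_C_mul, Submodule.coe_sum, Submodule.coe_smul, Finset.sum_apply,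
      Pi.smul_apply, smul_eq_mul, Finset.mul_sum]
    refine Finset.sum_congr rfl fun m _ => ?_
    ring
  rw [h]
  refine Submodule.sum_mem _ fun k hk => Submodule.sum_mem _ fun m hm =>
    Submodule.smul_mem _ _ (Submodule.subset_span ⟨m, ?_, rfl⟩)
  exact Finset.mem_coe.2 (Finset.mem_biUnion.2 ⟨k, hk, hm⟩)

end Directional
section MeanValue

open Filter Topology
open scoped Convolution ContDiff

variable {ν : Measure E3} [IsFiniteMeasure ν] {R : ℝ}

theorem integrable_of_continuous (hR : ∀ᵐ y ∂ν, ‖y‖ ≤ R) {h : E3 → ℝ} (hh : Continuous h) :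
    Integrable h ν := by
  obtain ⟨K, hK⟩ := (isCompact_closedBall (0 : E3) R).exists_bound_of_continuousOn hh.continuousOn
  refine Integrable.of_bound hh.aestronglyMeasurable K ?_
  filter_upwards [hR] with y hy
  exact hK y (by simpa using hy)

theorem hasDerivAt_integral_of_continuous (hR : ∀ᵐ y ∂ν, ‖y‖ ≤ R) {F F' : E3 → E3 → ℝ}
    (hF : Continuous fun q : E3 × E3 => F q.1 q.2)
    (hF' : Continuous fun q : E3 × E3 => F' q.1 q.2) (x : E3)
    (hd : ∀ y (s : ℝ), HasDerivAt (fun s : ℝ => F y (x + s • y)) (F' y (x + s • y)) s) (s : ℝ) :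
    HasDerivAt (fun s : ℝ => ∫ y, F y (x + s • y) ∂ν) (∫ y, F' y (x + s • y) ∂ν) s := by
  have hc : Continuous fun q : ℝ × E3 => F' q.2 (x + q.1 • q.2) :=
    hF'.comp (f := fun q : ℝ × E3 => (q.2, x + q.1 • q.2)) (by fun_prop)
  have h1 : ∀ s : ℝ, Continuous fun y : E3 => F y (x + s • y) := fun s =>
    hF.comp (f := fun y : E3 => (y, x + s • y)) (by fun_prop)
  have h2 : Continuous fun y : E3 => F' y (x + s • y) :=
    hF'.comp (f := fun y : E3 => (y, x + s • y)) (by fun_prop)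
  have hcomp : IsCompact (Metric.closedBall s 1 ×ˢ Metric.closedBall (0 : E3) R) :=
    (isCompact_closedBall s 1).prod (isCompact_closedBall (0 : E3) R)
  obtain ⟨K, hK⟩ := hcomp.exists_bound_of_continuousOn hc.continuousOn
  refine (hasDerivAt_integral_of_dominated_loc_of_deriv_le (bound := fun _ => K)
    (F := fun (s : ℝ) y => F y (x + s • y))
    (F' := fun (s : ℝ) y => F' y (x + s • y))
    (Metric.closedBall_mem_nhds s one_pos)
    (Eventually.of_forall fun s => (h1 s).aestronglyMeasurable)
    (integrable_of_continuous hR (h1 s)) h2.aestronglyMeasurable ?_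
    (integrable_const K) ?_).2
  · filter_upwards [hR] with y hy t ht
    exact hK (t, y) ⟨ht, by simpa using hy⟩
  · exact Eventually.of_forall fun y t _ => hd y t

theorem hasDerivAt_integral_diffOp (hR : ∀ᵐ y ∂ν, ‖y‖ ≤ R) (k : ℕ) (g : smoothFn) (x : E3)
    (s : ℝ) :
    HasDerivAt (fun s : ℝ => ∫ y, (diffOp (linForm y ^ k) g).1 (x + s • y) ∂ν)
      (∫ y, (diffOp (linForm y ^ (k + 1)) g).1 (x + s • y) ∂ν) s :=
  hasDerivAt_integral_of_continuous hR
    (F := fun y z => (diffOp (linForm y ^ k) g).1 z)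
    (F' := fun y z => (diffOp (linForm y ^ (k + 1)) g).1 z)
    (continuous_diffOp_linForm_pow k g) (continuous_diffOp_linForm_pow (k + 1) g) x
    (fun y s => hasDerivAt_diffOp_linForm_pow k g x y s) s

/-- The differential operator symbol of the `k`-th directional derivative averaged over `ν`. -/
noncomputable def momentPoly (ν : Measure E3) (k : ℕ) : MvPolynomial (Fin 3) ℝ :=
  ∑ m ∈ Finset.piAntidiag (Finset.univ : Finset (Fin 3)) k,
    C (Nat.multinomial Finset.univ m * ∫ y, ∏ i, y i ^ m i ∂ν) * ∏ i, X i ^ m i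

theorem diffOp_momentPoly (hR : ∀ᵐ y ∂ν, ‖y‖ ≤ R) (k : ℕ) (g : smoothFn) (x : E3) :
    (diffOp (momentPoly ν k) g).1 x = ∫ y, (diffOp (linForm y ^ k) g).1 x ∂ν := by
  simp only [linForm_pow, momentPoly, map_sum, LinearMap.sum_apply, diffOp_C_mul,
    Submodule.coe_sum, Submodule.coe_smul, Finset.sum_apply, Pi.smul_apply, smul_eq_mul]
  rw [integral_finsetSum]
  · refine Finset.sum_congr rfl fun m _ => ?_
    rw [integral_mul_const, integral_const_mul]
  · intro m _
    refine integrable_of_continuous hR ?_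
    refine (continuous_const.mul (continuous_finsetProd _ fun i _ => ?_)).mul continuous_const
    exact (coordL i).continuous.pow _

theorem diffOp_momentPoly_eq_zero (hR : ∀ᵐ y ∂ν, ‖y‖ ≤ R) {g : smoothFn}
    (hg : ∀ x (s : ℝ), 0 < s → g.1 x * ν.real Set.univ = ∫ y, g.1 (x + s • y) ∂ν)
    {k : ℕ} (hk : k ≠ 0) : diffOp (momentPoly ν k) g = 0 := by
  refine Subtype.ext (funext fun x => ?_)
  rw [diffOp_momentPoly hR]
  have hd := fun j s => hasDerivAt_integral_diffOp hR j g x s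
  have hpos : ∀ j, ∀ s : ℝ, 0 < s →
      ∫ y, (diffOp (linForm y ^ (j + 1)) g).1 (x + s • y) ∂ν = 0 := by
    intro j
    induction j with
    | zero =>
      intro s hs
      refine (hd 0 s).unique ?_
      refine (hasDerivAt_const s (g.1 x * ν.real Set.univ)).congr_of_eventuallyEq ?_
      filter_upwards [lt_mem_nhds hs] with t ht
      simp [hg x t ht]
    | succ j ih =>
      intro s hs
      refine (hd (j + 1) s).unique ?_
      refine (hasDerivAt_const s (0 : ℝ)).congr_of_eventuallyEq ?_
      filter_upwards [lt_mem_nhds hs] with t ht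
      exact ih t ht
  obtain ⟨j, rfl⟩ := Nat.exists_eq_succ_of_ne_zero hk
  have ht := ((hd (j + 1) 0).continuousAt.tendsto).mono_left
    (nhdsWithin_le_nhds (s := Set.Ioi (0 : ℝ)))
  have h0 : Tendsto (fun s : ℝ => ∫ y, (diffOp (linForm y ^ (j + 1)) g).1 (x + s • y) ∂ν)
      (𝓝[>] 0) (𝓝 0) := by
    refine tendsto_const_nhds.congr' ?_
    filter_upwards [self_mem_nhdsWithin] with s hs
    exact (hpos j s hs).symm
  have := tendsto_nhds_unique ht h0
  simpa using this

theorem integral_eq_of_diffOp_momentPoly_eq_zero (hR : ∀ᵐ y ∂ν, ‖y‖ ≤ R) {g : smoothFn} {N : ℕ}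
    (hN : ∀ y, diffOp (linForm y ^ N) g = 0)
    (hg : ∀ k, k ≠ 0 → diffOp (momentPoly ν k) g = 0) (x : E3) (s : ℝ) :
    ∫ y, g.1 (x + s • y) ∂ν = g.1 x * ν.real Set.univ := by
  have h := eq_taylor_sum (N + 1)
    (fun k s => ∫ y, (diffOp (linForm y ^ k) g).1 (x + s • y) ∂ν)
    (fun k s => hasDerivAt_integral_diffOp hR k g x s) (fun t => by
      simp only [pow_succ', map_mul, Module.End.mul_apply, hN, map_zero, Submodule.coe_zero,
        Pi.zero_apply, integral_zero]) s
  rw [Finset.sum_range_succ', Finset.sum_eq_zero] at h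
  · simpa [mul_comm] using h
  · intro k _
    have h1 := congrFun (congrArg Subtype.val (hg (k + 1) (by simp))) x
    rw [diffOp_momentPoly hR] at h1
    simp only [zero_smul, add_zero]
    rw [h1]
    simp

theorem exists_smooth_approx (hR : ∀ᵐ y ∂ν, ‖y‖ ≤ R) {f : E3 → ℝ} (hf : Continuous f)
    (hm : ∀ x (s : ℝ), 0 < s → f x * ν.real Set.univ = ∫ y, f (x + s • y) ∂ν) :
    ∃ g : ℕ → smoothFn, (∀ n x (s : ℝ), 0 < s →
      (g n).1 x * ν.real Set.univ = ∫ y, (g n).1 (x + s • y) ∂ν) ∧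
      ∀ x, Tendsto (fun n => (g n).1 x) atTop (𝓝 (f x)) := by
  let φ : ℕ → ContDiffBump (0 : E3) := fun n =>
    ⟨1 / (2 * ((n : ℝ) + 1)), 1 / ((n : ℝ) + 1), by positivity, by
      apply one_div_lt_one_div_of_lt <;> [positivity; linarith [(n.cast_nonneg : (0 : ℝ) ≤ n)]]⟩
  have hφ : Tendsto (fun n => (φ n).rOut) atTop (𝓝 0) := tendsto_one_div_add_atTop_nhds_zero_nat
  refine ⟨fun n => ⟨(φ n).normed volume ⋆[ContinuousLinearMap.lsmul ℝ ℝ, volume] f, ?_⟩,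
    fun n x s hs => ?_, fun x => ?_⟩
  · exact (φ n).hasCompactSupport_normed.contDiff_convolution_left _ (φ n).contDiff_normed
      hf.locallyIntegrable
  · simp only [convolution, ContinuousLinearMap.lsmul_apply, smul_eq_mul]
    rw [integral_integral_swap, ← integral_mul_const]
    · refine integral_congr_ae (Eventually.of_forall fun z => ?_)
      simp only
      rw [integral_const_mul, mul_assoc, hm (x - z) s hs]
      simp only [sub_add_eq_add_sub]
    · have hcont : Continuous fun q : E3 × E3 => f (x + s • q.1 - q.2) := by fun_prop
      have hφc : Continuous ((φ n).normed volume) := (φ n).continuous_normed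
      obtain ⟨K, hK⟩ := ((isCompact_closedBall (0 : E3) R).prod
        (isCompact_closedBall (0 : E3) (φ n).rOut)).exists_bound_of_continuousOn
          hcont.continuousOn
      have hint : Integrable (fun q : E3 × E3 => K * (φ n).normed volume q.2)
          (ν.prod volume) := by
        have := (integrable_const (μ := ν) K).mul_prod
          ((φ n).integrable_normed (μ := volume))
        exact this
      refine hint.mono' (Continuous.aestronglyMeasurable
        ((hφc.comp continuous_snd).mul hcont)) ?_
      have hR' : ∀ᵐ q : E3 × E3 ∂(ν.prod volume), ‖q.1‖ ≤ R :=
        Measure.quasiMeasurePreserving_fst.ae hR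
      filter_upwards [hR'] with q hq
      have hnn := (φ n).nonneg_normed (μ := volume) q.2
      simp only [Function.uncurry]
      rw [norm_mul, Real.norm_of_nonneg hnn, mul_comm]
      by_cases h2 : q.2 ∈ Metric.closedBall (0 : E3) (φ n).rOut
      · exact mul_le_mul_of_nonneg_right (hK q ⟨by simpa using hq, h2⟩) hnn
      · have : (φ n).normed volume q.2 = 0 := by
          by_contra h3
          have h4 : q.2 ∈ Function.support ((φ n).normed volume) := h3
          rw [(φ n).support_normed_eq] at h4
          exact h2 (Metric.ball_subset_closedBall h4)
        simp [this]
  · exact ContDiffBump.convolution_tendsto_right_of_continuous hφ hf x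

end MeanValue

section EdgeMeasure

theorem restrict_segment_eq (x y : E3) :
    (μH[1] : Measure E3).restrict (segment ℝ x y) =
      (nndist x y : ENNReal) • (volume.restrict (Set.Icc (0 : ℝ) 1)).map
        (AffineMap.lineMap x y : ℝ → E3) := by
  have hm : Measurable (AffineMap.lineMap x y : ℝ → E3) :=
    (AffineMap.lineMap_continuous).measurable
  ext s hs
  rw [Measure.restrict_apply hs, segment_eq_image_lineMap, ← Set.image_preimage_inter,
    hausdorffMeasure_lineMap_image, hausdorffMeasure_real, Measure.smul_apply,
    Measure.map_apply hm hs, Measure.restrict_apply (hm hs)]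
  rfl

/-- Index set of the edges of the triakis octahedron: the edges of the octahedron, and those joining
an apex to a vertex of the octahedron. -/
abbrev EdgeIdx : Type := (Fin 3 × Bool × Bool) ⊕ (Fin 3 × Bool × Bool × Bool)

/-- First end point of an edge. -/
noncomputable def edgeStart : EdgeIdx → E3
  | .inl (0, a, _) => vA a
  | .inl (1, a, _) => vA a
  | .inl (2, b, _) => vB b
  | .inr (0, a, _, _) => vA a
  | .inr (1, _, b, _) => vB b
  | .inr (2, _, _, c) => vC c

/-- Second end point of an edge. -/
noncomputable def edgeEnd (r : ℝ) : EdgeIdx → E3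
  | .inl (0, _, b) => vB b
  | .inl (1, _, c) => vC c
  | .inl (2, _, c) => vC c
  | .inr (_, a, b, c) => vD r a b c

/-- Parametrization of an edge by the unit interval, in coordinates. -/
noncomputable def edgePt (r : ℝ) (t : ℝ) : EdgeIdx → Fin 3 → ℝ
  | .inl (0, a, b) => ![(1 - t) * sg a, t * sg b, 0]
  | .inl (1, a, c) => ![(1 - t) * sg a, 0, t * sg c]
  | .inl (2, b, c) => ![0, (1 - t) * sg b, t * sg c]
  | .inr (0, a, b, c) => ![(1 - t + t * (r / 3)) * sg a, t * (r / 3) * sg b, t * (r / 3) * sg c]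
  | .inr (1, a, b, c) => ![t * (r / 3) * sg a, (1 - t + t * (r / 3)) * sg b, t * (r / 3) * sg c]
  | .inr (2, a, b, c) => ![t * (r / 3) * sg a, t * (r / 3) * sg b, (1 - t + t * (r / 3)) * sg c]

/-- Recovers the edge containing a given point of the skeleton which is not a vertex. -/
noncomputable def edgeOf (x : Fin 3 → ℝ) : EdgeIdx :=
  open scoped Classical in
  if x 2 = 0 then .inl (0, decide (0 < x 0), decide (0 < x 1))
  else if x 1 = 0 then .inl (1, decide (0 < x 0), decide (0 < x 2))
  else if x 0 = 0 then .inl (2, decide (0 < x 1), decide (0 < x 2))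
  else .inr (if |x 1| < |x 0| then 0 else if |x 0| < |x 1| then 1 else 2,
    decide (0 < x 0), decide (0 < x 1), decide (0 < x 2))

theorem edgeSet_eq_iUnion (r : ℝ) :
    edgeSet r = ⋃ i : EdgeIdx, segment ℝ (edgeStart i) (edgeEnd r i) := by
  ext x
  simp only [edgeSet, Set.mem_union, Set.mem_iUnion, Sum.exists, Prod.exists, Fin.exists_fin_succ,
    edgeStart, edgeEnd, exists_or]
  simp [or_assoc]

theorem lineMap_edge_apply (r t : ℝ) (i : EdgeIdx) (k : Fin 3) :
    (AffineMap.lineMap (edgeStart i) (edgeEnd r i) t : E3) k = edgePt r t i k := by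
  rw [AffineMap.lineMap_apply_module]
  rcases i with ⟨j, a, b⟩ | ⟨j, a, b, c⟩ <;> fin_cases j <;> fin_cases k <;>
    simp [edgeStart, edgeEnd, edgePt, vA, vB, vC, vD, pt] <;> ring

theorem sg_pos_iff (b : Bool) : 0 < sg b ↔ b = true := by
  cases b <;> simp [sg]

theorem abs_sg (b : Bool) : |sg b| = 1 := by
  cases b <;> simp [sg]

theorem sg_ne_zero (b : Bool) : sg b ≠ 0 := by
  cases b <;> simp [sg]

theorem edgeOf_edgePt {r t : ℝ} (hr : 0 < r) (h0 : 0 < t) (h1 : t < 1) (i : EdgeIdx) :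
    edgeOf (edgePt r t i) = i := by
  have hp : 0 < 1 - t := by linarith
  have hq : 0 < t * (r / 3) := by positivity
  have hs : 0 < 1 - t + t * (r / 3) := by linarith
  have hlt : t * (r / 3) < 1 - t + t * (r / 3) := by linarith
  rcases i with ⟨j, a, b⟩ | ⟨j, a, b, c⟩ <;> fin_cases j <;>
    simp [edgeOf, edgePt, -mul_eq_zero, mul_eq_zero_iff_left, sg_ne_zero, sg_pos_iff, h0, hp, hq,
      hs, h0.ne', hp.ne', hq.ne', hs.ne', abs_mul, abs_sg, abs_of_pos, hlt, hlt.not_gt, mul_pos_iff_of_pos_left]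

theorem nndist_edge (r : ℝ) (i : EdgeIdx) :
    ((nndist (edgeStart i) (edgeEnd r i) : NNReal) : ℝ) =
      Sum.elim (fun _ => √2) (fun _ => √((r ^ 2 - 2 * r + 3) / 3)) i := by
  rw [coe_nndist, EuclideanSpace.dist_eq, Fin.sum_univ_three]
  rcases i with ⟨j, a, b⟩ | ⟨j, a, b, c⟩
  · fin_cases j <;> cases a <;> cases b <;>
      simp [edgeStart, edgeEnd, vA, vB, vC, pt, sg, Real.dist_eq] <;> norm_num
  · refine congrArg Real.sqrt ?_
    fin_cases j <;> cases a <;> cases b <;> cases c <;>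
      simp [edgeStart, edgeEnd, vA, vB, vC, vD, pt, sg, Real.dist_eq] <;> ring_nf

theorem aedisjoint_edges {r : ℝ} (hr : 0 < r) :
    Pairwise (Function.onFun (AEDisjoint (μH[1] : Measure E3))
      fun i => segment ℝ (edgeStart i) (edgeEnd r i)) := by
  have := Measure.nullSingletonClass_hausdorff E3 (d := 1) one_pos
  intro i j hij
  refine measure_mono_null (t := {edgeStart i, edgeEnd r i, edgeStart j, edgeEnd r j}) ?_
    (Set.Finite.measure_zero (Set.toFinite _) _)
  have key : ∀ i : EdgeIdx, ∀ x ∈ segment ℝ (edgeStart i) (edgeEnd r i),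
      x ≠ edgeStart i → x ≠ edgeEnd r i → edgeOf (fun k => x k) = i := by
    intro i x hx h1 h2
    rw [segment_eq_image_lineMap] at hx
    obtain ⟨t, ⟨h3, h4⟩, rfl⟩ := hx
    simp only [lineMap_edge_apply]
    refine edgeOf_edgePt hr (lt_of_le_of_ne h3 ?_) (lt_of_le_of_ne h4 ?_) i
    · rintro rfl
      simp at h1
    · rintro rfl
      simp at h2
  rintro x ⟨hi, hj⟩
  by_contra hx
  simp only [Set.mem_insert_iff, Set.mem_singleton_iff, not_or] at hx
  exact hij ((key i x hi hx.1 hx.2.1).symm.trans (key j x hj hx.2.2.1 hx.2.2.2))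

theorem restrict_edgeSet {r : ℝ} (hr : 0 < r) :
    (μH[1] : Measure E3).restrict (edgeSet r) =
      ∑ i : EdgeIdx, (nndist (edgeStart i) (edgeEnd r i) : ENNReal) •
        (volume.restrict (Set.Icc (0 : ℝ) 1)).map
          (AffineMap.lineMap (edgeStart i) (edgeEnd r i) : ℝ → E3) := by
  have hm : ∀ i, MeasurableSet (segment ℝ (edgeStart i) (edgeEnd r i)) := fun i => by
    rw [segment_eq_image_lineMap]
    exact (isCompact_Icc.image AffineMap.lineMap_continuous).measurableSet
  rw [edgeSet_eq_iUnion, Measure.restrict_iUnion_ae (aedisjoint_edges hr)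
    fun i => (hm i).nullMeasurableSet, Measure.sum_fintype]
  exact Finset.sum_congr rfl fun i _ => restrict_segment_eq _ _

theorem isCompact_edgeSet (r : ℝ) : IsCompact (edgeSet r) := by
  rw [edgeSet_eq_iUnion]
  refine isCompact_iUnion fun i => ?_
  rw [segment_eq_image_lineMap]
  exact isCompact_Icc.image AffineMap.lineMap_continuous

theorem isFiniteMeasure_edgeSet {r : ℝ} (hr : 0 < r) :
    IsFiniteMeasure ((μH[1] : Measure E3).restrict (edgeSet r)) := by
  rw [restrict_edgeSet hr]
  have : ∀ i : EdgeIdx, IsFiniteMeasure ((nndist (edgeStart i) (edgeEnd r i) : ENNReal) •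
        (volume.restrict (Set.Icc (0 : ℝ) 1)).map
          (AffineMap.lineMap (edgeStart i) (edgeEnd r i) : ℝ → E3)) := fun i =>
    Measure.smul_finite _ ENNReal.coe_ne_top
  infer_instance

theorem exists_norm_le_edgeSet (r : ℝ) :
    ∃ R : ℝ, ∀ᵐ y ∂((μH[1] : Measure E3).restrict (edgeSet r)), ‖y‖ ≤ R := by
  obtain ⟨R, hR⟩ := (isCompact_edgeSet r).isBounded.exists_norm_le
  exact ⟨R, ae_restrict_of_forall_mem (isCompact_edgeSet r).measurableSet hR⟩

/-- The length of an edge. -/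
noncomputable def edgeLength (r : ℝ) : EdgeIdx → ℝ :=
  Sum.elim (fun _ => √2) (fun _ => √((r ^ 2 - 2 * r + 3) / 3))

theorem integral_edgeSet {r : ℝ} (hr : 0 < r) {h : E3 → ℝ} (hh : Continuous h) :
    ∫ y in edgeSet r, h y ∂(μH[1]) = ∑ i, edgeLength r i *
      ∫ t in (0 : ℝ)..1, h (AffineMap.lineMap (edgeStart i) (edgeEnd r i) t) := by
  rw [restrict_edgeSet hr]
  have hc : ∀ i, Continuous (AffineMap.lineMap (edgeStart i) (edgeEnd r i) : ℝ → E3) := fun i =>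
    AffineMap.lineMap_continuous
  have hae : ∀ (i) (μ : Measure ℝ), AEMeasurable
      (AffineMap.lineMap (edgeStart i) (edgeEnd r i) : ℝ → E3) μ := fun i μ =>
    (hc i).measurable.aemeasurable
  rw [integral_finsetSum_measure]
  · refine Finset.sum_congr rfl fun i _ => ?_
    rw [integral_smul_measure, integral_map (hae i _) hh.aestronglyMeasurable,
      intervalIntegral.integral_of_le zero_le_one, integral_Icc_eq_integral_Ioc,
      ENNReal.coe_toReal, nndist_edge, smul_eq_mul]
    rfl
  · intro i _
    refine Integrable.smul_measure ?_ ENNReal.coe_ne_top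
    rw [integrable_map_measure hh.aestronglyMeasurable (hae i _)]
    exact (hh.comp (hc i)).continuousOn.integrableOn_compact isCompact_Icc

/-- The beta integrals arising from the octahedron edges. -/
noncomputable def octMoment (i j : ℕ) : ℝ := ∫ t in (0 : ℝ)..1, (1 - t) ^ i * t ^ j

/-- The integrals arising from the edges at an apex, where `ρ = r / 3`. -/
noncomputable def apexMoment (ρ : ℝ) (i n : ℕ) : ℝ :=
  ∫ t in (0 : ℝ)..1, (1 - t + t * ρ) ^ i * (t * ρ) ^ n

/-- The moments of the edge measure. -/
noncomputable def edgeMoment (r : ℝ) (i j l : ℕ) : ℝ :=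
  √2 * ((1 + (-1) ^ i) * (1 + (-1) ^ j) * 0 ^ l * octMoment i j +
      (1 + (-1) ^ i) * (1 + (-1) ^ l) * 0 ^ j * octMoment i l +
      (1 + (-1) ^ j) * (1 + (-1) ^ l) * 0 ^ i * octMoment j l) +
    √((r ^ 2 - 2 * r + 3) / 3) * ((1 + (-1) ^ i) * (1 + (-1) ^ j) * (1 + (-1) ^ l)) *
      (apexMoment (r / 3) i (j + l) + apexMoment (r / 3) j (i + l) + apexMoment (r / 3) l (i + j))

theorem integral_edge_monomial (r : ℝ) (m : Fin 3 → ℕ) (i : EdgeIdx) :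
    ∫ t in (0 : ℝ)..1, ∏ k, edgePt r t i k ^ m k =
      match i with
      | .inl (0, a, b) => sg a ^ m 0 * sg b ^ m 1 * 0 ^ m 2 * octMoment (m 0) (m 1)
      | .inl (1, a, c) => sg a ^ m 0 * sg c ^ m 2 * 0 ^ m 1 * octMoment (m 0) (m 2)
      | .inl (2, b, c) => sg b ^ m 1 * sg c ^ m 2 * 0 ^ m 0 * octMoment (m 1) (m 2)
      | .inr (0, a, b, c) =>
        sg a ^ m 0 * sg b ^ m 1 * sg c ^ m 2 * apexMoment (r / 3) (m 0) (m 1 + m 2)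
      | .inr (1, a, b, c) =>
        sg a ^ m 0 * sg b ^ m 1 * sg c ^ m 2 * apexMoment (r / 3) (m 1) (m 0 + m 2)
      | .inr (2, a, b, c) =>
        sg a ^ m 0 * sg b ^ m 1 * sg c ^ m 2 * apexMoment (r / 3) (m 2) (m 0 + m 1) := by
  rcases i with ⟨j, a, b⟩ | ⟨j, a, b, c⟩ <;> fin_cases j <;>
    simp only [octMoment, apexMoment, ← intervalIntegral.integral_const_mul] <;>
    refine intervalIntegral.integral_congr fun t _ => ?_ <;>
    simp [Fin.prod_univ_three, edgePt, mul_pow, pow_add] <;> ring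

theorem integral_edgeSet_monomial {r : ℝ} (hr : 0 < r) (m : Fin 3 → ℕ) :
    ∫ y in edgeSet r, ∏ k, y k ^ m k ∂(μH[1]) = edgeMoment r (m 0) (m 1) (m 2) := by
  have hc : Continuous fun y : E3 => ∏ k, y k ^ m k :=
    continuous_finsetProd _ fun i _ => (coordL i).continuous.pow _
  rw [integral_edgeSet hr hc]
  simp only [lineMap_edge_apply, integral_edge_monomial]
  simp [Fintype.sum_sum_type, Fintype.sum_prod_type, Fin.sum_univ_three, edgeLength, sg,
    edgeMoment]
  ring

theorem octMoment_comm (i j : ℕ) : octMoment i j = octMoment j i := by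
  have h := intervalIntegral.integral_comp_sub_left (a := 0) (b := 1)
    (fun t : ℝ => (1 - t) ^ j * t ^ i) 1
  simp only [sub_sub_cancel, sub_self, sub_zero] at h
  rw [octMoment, octMoment, ← h]
  exact intervalIntegral.integral_congr fun t _ => mul_comm _ _

theorem edgeMoment_swap_left (r : ℝ) (i j l : ℕ) : edgeMoment r i j l = edgeMoment r j i l := by
  rw [edgeMoment, edgeMoment, octMoment_comm i j, add_comm i j]
  ring

theorem edgeMoment_swap_right (r : ℝ) (i j l : ℕ) : edgeMoment r i j l = edgeMoment r i l j := by
  rw [edgeMoment, edgeMoment, octMoment_comm j l, add_comm j l]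
  ring

theorem edgeMoment_eq_zero (r : ℝ) {i j l : ℕ} (h : ¬ (Even i ∧ Even j ∧ Even l)) :
    edgeMoment r i j l = 0 := by
  have h0 : ∀ {n : ℕ}, ¬ Even n → (1 + (-1) ^ n : ℝ) = 0 ∧ (0 : ℝ) ^ n = 0 := by
    intro n hn
    have hn' := Nat.not_even_iff_odd.1 hn
    exact ⟨by rw [hn'.neg_one_pow]; norm_num, zero_pow hn'.pos.ne'⟩
  by_cases hi : Even i
  · by_cases hj : Even j
    · have hl : ¬ Even l := fun hl => h ⟨hi, hj, hl⟩
      simp [edgeMoment, h0 hl]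
    · simp [edgeMoment, h0 hj]
  · simp [edgeMoment, h0 hi]

end EdgeMeasure

section Coefficients

theorem integral_one_add_mul_pow (c : ℝ) (i n : ℕ) :
    ∫ t in (0 : ℝ)..1, (1 + t * c) ^ i * t ^ n =
      ∑ k ∈ Finset.range (i + 1), (i.choose k : ℝ) * c ^ k / (k + n + 1) := by
  have h : ∀ t : ℝ, (1 + t * c) ^ i * t ^ n =
      ∑ k ∈ Finset.range (i + 1), ((i.choose k : ℝ) * c ^ k) * t ^ (k + n) := by
    intro t
    rw [add_comm, add_pow, Finset.sum_mul]
    refine Finset.sum_congr rfl fun k _ => ?_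
    rw [mul_pow, one_pow, pow_add]
    ring
  simp only [h]
  rw [intervalIntegral.integral_finsetSum]
  · refine Finset.sum_congr rfl fun k _ => ?_
    rw [intervalIntegral.integral_const_mul, integral_pow]
    simp [div_eq_mul_inv]
  · intro k _
    exact (by fun_prop : Continuous _).intervalIntegrable _ _

theorem octMoment_eq_sum (i j : ℕ) :
    octMoment i j =
      ∑ k ∈ Finset.range (i + 1), (i.choose k : ℝ) * (-1) ^ k / (k + j + 1) := by
  rw [← integral_one_add_mul_pow, octMoment]
  refine intervalIntegral.integral_congr fun t _ => ?_
  ring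

theorem apexMoment_eq_sum (ρ : ℝ) (i n : ℕ) :
    apexMoment ρ i n = ρ ^ n *
      ∑ k ∈ Finset.range (i + 1), (i.choose k : ℝ) * (ρ - 1) ^ k / (k + n + 1) := by
  rw [← integral_one_add_mul_pow, apexMoment, ← intervalIntegral.integral_const_mul]
  refine intervalIntegral.integral_congr fun t _ => ?_
  ring

theorem edgeMoment_two (r : ℝ) :
    edgeMoment r 2 0 0 = √2 * (8 / 3) +
      √((r ^ 2 - 2 * r + 3) / 3) * (8 / 3 * (1 + r / 3 + 3 * (r / 3) ^ 2)) := by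
  simp [edgeMoment, octMoment_eq_sum, apexMoment_eq_sum, Finset.sum_range_succ, Nat.choose]
  ring

theorem edgeMoment_four (r : ℝ) :
    6 * edgeMoment r 2 2 0 - 2 * edgeMoment r 4 0 0 = -(4 / 5) * (3 * √2 +
      4 * (√((r ^ 2 - 2 * r + 3) / 3) * ((27 + 9 * r - 2 * r ^ 3 - 2 * r ^ 4) / 27))) := by
  simp [edgeMoment, octMoment_eq_sum, apexMoment_eq_sum, Finset.sum_range_succ, Nat.choose]
  ring

theorem edgeMoment_six (r : ℝ) :
    3 * edgeMoment r 6 0 0 - 45 * edgeMoment r 4 2 0 + 90 * edgeMoment r 2 2 2 =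
      √2 * (12 / 7) + √((r ^ 2 - 2 * r + 3) / 3) *
        (24 / 7 * (1 + r / 3 - 2 * (r / 3) ^ 3 + 16 * (r / 3) ^ 5 + 48 * (r / 3) ^ 6)) := by
  simp [edgeMoment, octMoment_eq_sum, apexMoment_eq_sum, Finset.sum_range_succ, Nat.choose]
  ring

theorem edgeMoment_eight (r : ℝ) :
    2 * edgeMoment r 8 0 0 - 56 * edgeMoment r 6 2 0 + 70 * edgeMoment r 4 4 0 =
      √2 * (4 / 3) + √((r ^ 2 - 2 * r + 3) / 3) *
        (16 / 9 * (1 + r / 3 - 2 * (r / 3) ^ 3 - 4 * (r / 3) ^ 4 - 4 * (r / 3) ^ 5 +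
          8 * (r / 3) ^ 7 + 24 * (r / 3) ^ 8)) := by
  simp [edgeMoment, octMoment_eq_sum, apexMoment_eq_sum, Finset.sum_range_succ, Nat.choose]
  ring

theorem edgeMoment_zero_pos (r : ℝ) : 0 < edgeMoment r 0 0 0 := by
  have h : edgeMoment r 0 0 0 = √2 * 12 + √((r ^ 2 - 2 * r + 3) / 3) * 24 := by
    simp [edgeMoment, octMoment_eq_sum, apexMoment_eq_sum]
    ring
  rw [h]
  positivity

theorem edgeMoment_two_pos {r : ℝ} (hr : 0 < r) : 0 < edgeMoment r 2 0 0 := by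
  rw [edgeMoment_two]
  positivity

theorem edgeMoment_six_pos {r : ℝ} (hr : 0 < r) :
    0 < 3 * edgeMoment r 6 0 0 - 45 * edgeMoment r 4 2 0 + 90 * edgeMoment r 2 2 2 := by
  rw [edgeMoment_six]
  obtain ⟨ρ, hρ⟩ : ∃ ρ, ρ = r / 3 := ⟨_, rfl⟩
  have h0 : 0 < ρ := by rw [hρ]; positivity
  rw [← hρ]
  have h : 0 < 1 + ρ - 2 * ρ ^ 3 + 16 * ρ ^ 5 + 48 * ρ ^ 6 := by
    have h1 : 0 ≤ ρ * (ρ ^ 2 - 1) ^ 2 := by positivity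
    have h2 : 0 < ρ ^ 5 := by positivity
    have h3 : 0 < ρ ^ 6 := by positivity
    nlinarith
  positivity

theorem edgeMoment_eight_pos {r : ℝ} (hr : 0 < r) :
    0 < 2 * edgeMoment r 8 0 0 - 56 * edgeMoment r 6 2 0 + 70 * edgeMoment r 4 4 0 := by
  rw [edgeMoment_eight]
  obtain ⟨ρ, hρ⟩ : ∃ ρ, ρ = r / 3 := ⟨_, rfl⟩
  have h0 : 0 < ρ := by rw [hρ]; positivity
  rw [← hρ]
  have h : 0 < 1 + ρ - 2 * ρ ^ 3 - 4 * ρ ^ 4 - 4 * ρ ^ 5 + 8 * ρ ^ 7 + 24 * ρ ^ 8 := by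
    nlinarith [mul_nonneg h0.le (sq_nonneg (ρ ^ 2 - 1 / 2)), sq_nonneg (ρ ^ 4 - 1 / 6),
      mul_nonneg (pow_pos h0 3).le (sq_nonneg (ρ ^ 2 - 1 / 2)), pow_pos h0 8, pow_pos h0 7,
      mul_nonneg h0.le (sq_nonneg (ρ ^ 3 - 1 / 2)), sq_nonneg (ρ ^ 2 - 1 / 2)]
  positivity

theorem edgeMoment_four_eq_zero_iff {r : ℝ} (hr : 0 < r) (r₁ : ℝ) (hr₁pos : 0 < r₁)
    (hr₁root : 16 * r₁ ^ 8 + 32 * r₁ ^ 7 + 40 * r₁ ^ 6 - 48 * r₁ ^ 5 - 396 * r₁ ^ 4 -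
      432 * r₁ ^ 3 - 810 * r₁ ^ 2 - 972 * r₁ - 729 = 0)
    (hr₁uniq : ∀ y : ℝ, 0 < y →
      16 * y ^ 8 + 32 * y ^ 7 + 40 * y ^ 6 - 48 * y ^ 5 - 396 * y ^ 4 -
        432 * y ^ 3 - 810 * y ^ 2 - 972 * y - 729 = 0 → y = r₁) :
    6 * edgeMoment r 2 2 0 - 2 * edgeMoment r 4 0 0 = 0 ↔ r = r₁ := by
  rw [edgeMoment_four]
  have hpos : ∀ y : ℝ, 0 ≤ (y ^ 2 - 2 * y + 3) / 3 := fun y => by nlinarith [sq_nonneg (y - 1)]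
  have hL := Real.sq_sqrt (hpos r)
  have h2 : √2 ^ 2 = (2 : ℝ) := Real.sq_sqrt (by norm_num)
  have hL0 := Real.sqrt_nonneg ((r ^ 2 - 2 * r + 3) / 3)
  have h20 := Real.sqrt_nonneg 2
  set L := √((r ^ 2 - 2 * r + 3) / 3)
  have key : (4 * (L * ((27 + 9 * r - 2 * r ^ 3 - 2 * r ^ 4) / 27))) ^ 2 - (3 * √2) ^ 2 =
      (2 / 2187) * ((2 * r ^ 2 - 4 * r + 3) * (16 * r ^ 8 + 32 * r ^ 7 + 40 * r ^ 6 - 48 * r ^ 5 -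
        396 * r ^ 4 - 432 * r ^ 3 - 810 * r ^ 2 - 972 * r - 729)) := by
    linear_combination (16 * ((27 + 9 * r - 2 * r ^ 3 - 2 * r ^ 4) / 27) ^ 2) * hL - 9 * h2
  constructor
  · intro h
    refine hr₁uniq r hr ?_
    have h3 : (4 * (L * ((27 + 9 * r - 2 * r ^ 3 - 2 * r ^ 4) / 27))) ^ 2 - (3 * √2) ^ 2 = 0 := by
      have : 4 * (L * ((27 + 9 * r - 2 * r ^ 3 - 2 * r ^ 4) / 27)) = - (3 * √2) := by linarith
      rw [this]
      ring
    rw [key] at h3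
    have h4 : 2 * r ^ 2 - 4 * r + 3 ≠ 0 := by nlinarith [sq_nonneg (r - 1)]
    simpa [h4] using h3
  · rintro rfl
    have hgt : 2 < r := by
      by_contra! hle
      have h8 : r ^ 8 ≤ 64 * r ^ 2 := by
        have : r ^ 6 ≤ 2 ^ 6 := pow_le_pow_left₀ hr.le hle 6
        nlinarith [sq_nonneg r]
      have h7 : r ^ 7 ≤ 8 * r ^ 4 := by
        have : r ^ 3 ≤ 2 ^ 3 := pow_le_pow_left₀ hr.le hle 3
        nlinarith [pow_pos hr 4]
      have h6 : r ^ 6 ≤ 8 * r ^ 3 := by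
        have : r ^ 3 ≤ 2 ^ 3 := pow_le_pow_left₀ hr.le hle 3
        nlinarith [pow_pos hr 3]
      nlinarith [pow_pos hr 5, pow_pos hr 4, pow_pos hr 3, pow_pos hr 2]
    have hq : 27 + 9 * r - 2 * r ^ 3 - 2 * r ^ 4 ≤ 0 := by
      have h3 : 4 * r ≤ r ^ 3 := by nlinarith
      have h4 : 8 * r ≤ r ^ 4 := by nlinarith
      nlinarith
    rw [hr₁root, mul_zero, mul_zero, sub_eq_zero, sq_eq_sq_iff_eq_or_eq_neg] at key
    have hle : 4 * (L * ((27 + 9 * r - 2 * r ^ 3 - 2 * r ^ 4) / 27)) ≤ 0 := by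
      have := mul_nonneg hL0 (neg_nonneg.2 hq)
      nlinarith
    rcases key with h | h <;> nlinarith

end Coefficients

section Symbols

/-- The symbol of the averaged directional derivative of order `2k`, in the squares of the
variables. -/
noncomputable def halfPoly (r : ℝ) (k : ℕ) : MvPolynomial (Fin 3) ℝ :=
  ∑ m ∈ Finset.piAntidiag (Finset.univ : Finset (Fin 3)) k,
    C (Nat.multinomial Finset.univ (2 • m) *
      edgeMoment r (2 * m 0) (2 * m 1) (2 * m 2)) * ∏ i, X i ^ m i

theorem momentPoly_edgeSet {r : ℝ} (hr : 0 < r) (k : ℕ) :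
    momentPoly ((μH[1] : Measure E3).restrict (edgeSet r)) k =
      ∑ m ∈ Finset.piAntidiag (Finset.univ : Finset (Fin 3)) k with ∀ i, 2 ∣ m i,
        C (Nat.multinomial Finset.univ m * edgeMoment r (m 0) (m 1) (m 2)) * ∏ i, X i ^ m i := by
  simp only [momentPoly, integral_edgeSet_monomial hr]
  refine (Finset.sum_filter_of_ne fun m _ hne => ?_).symm
  by_contra h
  refine hne ?_
  rw [edgeMoment_eq_zero, mul_zero, C_0, zero_mul]
  simpa [Fin.forall_fin_succ, even_iff_two_dvd] using h

theorem momentPoly_edgeSet_of_odd {r : ℝ} (hr : 0 < r) {k : ℕ} (hk : Odd k) :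
    momentPoly ((μH[1] : Measure E3).restrict (edgeSet r)) k = 0 := by
  rw [momentPoly_edgeSet hr]
  refine Finset.sum_eq_zero fun m hm => ?_
  simp only [Finset.mem_filter, Finset.mem_piAntidiag] at hm
  have : 2 ∣ k := hm.1.1 ▸ Finset.dvd_sum fun i _ => hm.2 i
  exact absurd (even_iff_two_dvd.2 this) (Nat.not_even_iff_odd.2 hk)

theorem momentPoly_edgeSet_two_mul {r : ℝ} (hr : 0 < r) (k : ℕ) :
    momentPoly ((μH[1] : Measure E3).restrict (edgeSet r)) (2 * k) =
      expand 2 (halfPoly r k) := by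
  have h := Finset.map_nsmul_piAntidiag_univ (ι := Fin 3) k two_ne_zero
  rw [momentPoly_edgeSet hr, Finset.sum_congr (by convert h.symm) fun _ _ => rfl, Finset.sum_map,
    halfPoly, map_sum]
  refine Finset.sum_congr rfl fun m _ => ?_
  simp [← pow_mul]

theorem isHomogeneous_halfPoly (r : ℝ) (k : ℕ) : (halfPoly r k).IsHomogeneous k := by
  rw [halfPoly]
  refine IsHomogeneous.sum _ _ _ fun m hm => ?_
  have h : (∏ i, X i ^ m i : MvPolynomial (Fin 3) ℝ).IsHomogeneous (∑ i, m i) := by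
    refine IsHomogeneous.prod _ _ _ fun i _ => ?_
    simpa using (isHomogeneous_X ℝ i).pow (m i)
  rw [(Finset.mem_piAntidiag.1 hm).1] at h
  rw [← zero_add k]
  exact (isHomogeneous_C (Fin 3) _).mul h

theorem edgeMoment_comp_perm (r : ℝ) (e : Equiv.Perm (Fin 3)) (m : Fin 3 → ℕ) :
    edgeMoment r (2 * m (e 0)) (2 * m (e 1)) (2 * m (e 2)) =
      edgeMoment r (2 * m 0) (2 * m 1) (2 * m 2) := by
  have h : ∀ e : Equiv.Perm (Fin 3),
      (e 0 = 0 ∧ e 1 = 1 ∧ e 2 = 2) ∨ (e 0 = 0 ∧ e 1 = 2 ∧ e 2 = 1) ∨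
      (e 0 = 1 ∧ e 1 = 0 ∧ e 2 = 2) ∨ (e 0 = 1 ∧ e 1 = 2 ∧ e 2 = 0) ∨
      (e 0 = 2 ∧ e 1 = 0 ∧ e 2 = 1) ∨ (e 0 = 2 ∧ e 1 = 1 ∧ e 2 = 0) := by decide
  generalize hM : (fun i => 2 * m i) = M
  have hM' : ∀ i, 2 * m i = M i := fun i => congrFun hM i
  simp only [hM']
  have hl := edgeMoment_swap_left r
  have hs := edgeMoment_swap_right r
  rcases h e with ⟨h0, h1, h2⟩ | ⟨h0, h1, h2⟩ | ⟨h0, h1, h2⟩ | ⟨h0, h1, h2⟩ | ⟨h0, h1, h2⟩ |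
    ⟨h0, h1, h2⟩ <;> rw [h0, h1, h2]
  · exact hs _ _ _
  · exact hl _ _ _
  · exact (hs _ _ _).trans (hl _ _ _)
  · exact (hl _ _ _).trans (hs _ _ _)
  · exact (hl _ _ _).trans ((hs _ _ _).trans (hl _ _ _))

theorem isSymmetric_halfPoly (r : ℝ) (k : ℕ) : (halfPoly r k).IsSymmetric := by
  intro e
  simp only [halfPoly, map_sum, map_mul, rename_C, map_prod, map_pow, rename_X]
  refine Finset.sum_nbij' (fun m => m ∘ e.symm) (fun m => m ∘ e) ?_ ?_ ?_ ?_ ?_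
  · intro m hm
    simpa [Equiv.sum_comp e.symm m] using hm
  · intro m hm
    simpa [Equiv.sum_comp e m] using hm
  · intro m _
    simp [Function.comp_assoc]
  · intro m _
    simp [Function.comp_assoc]
  · intro m _
    have h1 : Nat.multinomial Finset.univ (2 • (m ∘ e.symm)) =
        Nat.multinomial Finset.univ (2 • m) := by
      simp only [Nat.multinomial, Pi.smul_apply, Function.comp_apply]
      rw [Equiv.sum_comp e.symm fun i => 2 • m i, Equiv.prod_comp e.symm fun i => (2 • m i).factorial]
    have h2 := edgeMoment_comp_perm r e.symm m
    have h3 : ∏ i, (X (e i) : MvPolynomial (Fin 3) ℝ) ^ m i = ∏ i, X i ^ m (e.symm i) := by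
      rw [← Equiv.prod_comp e fun i => (X i : MvPolynomial (Fin 3) ℝ) ^ m (e.symm i)]
      simp
    simp only [Function.comp_apply]
    rw [h1, h2, h3]

/-- The ideal of the symbols that vanish on all harmonic functions of the edge skeleton. -/
noncomputable def symbolIdeal : Ideal (MvPolynomial (Fin 3) ℝ) := Ideal.span {e2, e6, e4 ^ 2}

theorem e2_mem_symbolIdeal : e2 ∈ symbolIdeal := Ideal.subset_span (by simp)

theorem e6_mem_symbolIdeal : e6 ∈ symbolIdeal := Ideal.subset_span (by simp)

theorem e4_sq_mem_symbolIdeal : e4 ^ 2 ∈ symbolIdeal := Ideal.subset_span (by simp)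

theorem expand_esymm_one : expand 2 (esymm (Fin 3) ℝ 1) = e2 := by
  simp [esymm_one, Fin.sum_univ_three, e2]

theorem expand_esymm_two : expand 2 (esymm (Fin 3) ℝ 2) = e4 := by
  have h : Finset.powersetCard 2 (Finset.univ : Finset (Fin 3)) = {{0, 1}, {0, 2}, {1, 2}} := by
    decide
  rw [esymm, h, Finset.sum_insert (by decide), Finset.sum_insert (by decide)]
  simp [e4]
  ring

theorem expand_esymm_three : expand 2 (esymm (Fin 3) ℝ 3) = e6 := by
  have h : Finset.powersetCard 3 (Finset.univ : Finset (Fin 3)) = {Finset.univ} := by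
    decide
  rw [esymm, h]
  simp [e6, Fin.prod_univ_three]

theorem isHomogeneous_esymm (k : ℕ) : (esymm (Fin 3) ℝ k).IsHomogeneous k := by
  refine IsHomogeneous.sum _ _ _ fun s hs => ?_
  have h : (∏ i ∈ s, X i : MvPolynomial (Fin 3) ℝ).IsHomogeneous (∑ i ∈ s, 1) :=
    IsHomogeneous.prod _ _ _ fun i _ => isHomogeneous_X ℝ i
  simpa [(Finset.mem_powersetCard.1 hs).2] using h

theorem isHomogeneous_C_mul_prod_esymm (c : ℝ) (α : Fin 3 → ℕ) :
    (C c * ∏ i : Fin 3, esymm (Fin 3) ℝ (i.val + 1) ^ α i).IsHomogeneous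
      (∑ i : Fin 3, (i.val + 1) * α i) := by
  rw [← zero_add (∑ i : Fin 3, (i.val + 1) * α i)]
  refine (isHomogeneous_C (Fin 3) c).mul (IsHomogeneous.prod Finset.univ
    (fun i : Fin 3 => esymm (Fin 3) ℝ (i.val + 1) ^ α i) (fun i => (i.val + 1) * α i) fun i _ => ?_)
  exact (isHomogeneous_esymm (i.val + 1)).pow (α i)

theorem expand_prod_esymm_mem_symbolIdeal (c : ℝ) (α : Fin 3 → ℕ)
    (h0 : ∑ i : Fin 3, (i.val + 1) * α i ≠ 0) (h2 : ∑ i : Fin 3, (i.val + 1) * α i ≠ 2) :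
    expand 2 (C c * ∏ i : Fin 3, esymm (Fin 3) ℝ (i.val + 1) ^ α i) ∈ symbolIdeal := by
  rw [map_mul]
  refine Ideal.mul_mem_left _ _ ?_
  simp only [Fin.sum_univ_three, Fin.val_zero, Fin.val_one, Fin.val_two] at h0 h2
  have h : expand 2 (∏ i : Fin 3, esymm (Fin 3) ℝ (i.val + 1) ^ α i) =
      e2 ^ α 0 * e4 ^ α 1 * e6 ^ α 2 := by
    rw [Fin.prod_univ_three, map_mul, map_mul, map_pow, map_pow, map_pow, ← expand_esymm_one,
      ← expand_esymm_two, ← expand_esymm_three]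
    rfl
  rw [h]
  by_cases h10 : α 0 = 0
  · by_cases h12 : α 2 = 0
    · have h11 : 2 ≤ α 1 := by
        rw [h10, h12] at h0 h2
        omega
      obtain ⟨j, hj⟩ := Nat.exists_eq_add_of_le h11
      rw [hj, pow_add]
      exact Ideal.mul_mem_right _ _ (Ideal.mul_mem_left _ _
        (Ideal.mul_mem_right _ _ e4_sq_mem_symbolIdeal))
    · exact Ideal.mul_mem_left _ _ (Ideal.pow_mem_of_mem _ e6_mem_symbolIdeal _
        (Nat.pos_of_ne_zero h12))
  · exact Ideal.mul_mem_right _ _ (Ideal.mul_mem_right _ _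
      (Ideal.pow_mem_of_mem _ e2_mem_symbolIdeal _ (Nat.pos_of_ne_zero h10)))

theorem expand_mem_symbolIdeal {Q : MvPolynomial (Fin 3) ℝ} {k : ℕ} (hQ : Q.IsSymmetric)
    (hk : Q.IsHomogeneous k) (h0 : k ≠ 0) (h2 : k ≠ 2) : expand 2 Q ∈ symbolIdeal := by
  obtain ⟨q, hq⟩ := esymmAlgHom_surjective ℝ (σ := Fin 3) (n := 3) le_rfl ⟨Q, hQ⟩
  have hq' : Q = aeval (fun i : Fin 3 => esymm (Fin 3) ℝ (i.val + 1)) q := by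
    rw [← esymmAlgHom_apply, hq]
  have hsum : Q = ∑ α ∈ q.support,
      homogeneousComponent k (C (coeff α q) * ∏ i : Fin 3, esymm (Fin 3) ℝ (i.val + 1) ^ α i) := by
    conv_lhs => rw [← homogeneousComponent_eq_self hk, hq', aeval_def, eval₂_eq', map_sum]
    rfl
  rw [hsum, map_sum]
  refine Ideal.sum_mem _ fun α _ => ?_
  rw [homogeneousComponent_of_mem (isHomogeneous_C_mul_prod_esymm (coeff α q) α)]
  split_ifs with hα
  · subst hα
    exact expand_prod_esymm_mem_symbolIdeal _ _ h0 h2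
  · rw [map_zero]
    exact zero_mem _

theorem momentPoly_mem_symbolIdeal {r : ℝ} (hr : 0 < r) {k : ℕ} (h0 : k ≠ 0) (h4 : k ≠ 4) :
    momentPoly ((μH[1] : Measure E3).restrict (edgeSet r)) k ∈ symbolIdeal := by
  rcases Nat.even_or_odd' k with ⟨n, rfl | rfl⟩
  · rw [momentPoly_edgeSet_two_mul hr]
    exact expand_mem_symbolIdeal (isSymmetric_halfPoly r n) (isHomogeneous_halfPoly r n)
      (by omega) (by omega)
  · rw [momentPoly_edgeSet_of_odd hr ⟨n, rfl⟩]
    exact zero_mem _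

theorem X_pow_ten_mem_symbolIdeal (i : Fin 3) : X i ^ 10 ∈ symbolIdeal := by
  have h3 : (X i ^ 2 : MvPolynomial (Fin 3) ℝ) ^ 3 = e2 * (X i ^ 2) ^ 2 - e4 * X i ^ 2 + e6 := by
    fin_cases i <;> simp [e2, e4, e6] <;> ring
  have h : (X i : MvPolynomial (Fin 3) ℝ) ^ 10 =
      e2 * (X i ^ 4 * (X i ^ 2) ^ 2 - e4 * X i ^ 4) + e6 * (X i ^ 4 - e4) + e4 ^ 2 * X i ^ 2 := by
    linear_combination (X i ^ 4 - e4) * h3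
  rw [h]
  exact add_mem (add_mem (Ideal.mul_mem_right _ _ e2_mem_symbolIdeal)
    (Ideal.mul_mem_right _ _ e6_mem_symbolIdeal)) (Ideal.mul_mem_right _ _ e4_sq_mem_symbolIdeal)

theorem linForm_pow_mem_symbolIdeal (y : E3) : linForm y ^ 28 ∈ symbolIdeal := by
  rw [linForm_pow]
  refine Ideal.sum_mem _ fun m hm => Ideal.mul_mem_left _ _ ?_
  obtain ⟨i, hi⟩ : ∃ i, 10 ≤ m i := by
    by_contra! h
    have h1 := (Finset.mem_piAntidiag.1 hm).1
    rw [Fin.sum_univ_three] at h1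
    have := h 0
    have := h 1
    have := h 2
    omega
  rw [← Finset.mul_prod_erase _ _ (Finset.mem_univ i)]
  obtain ⟨j, hj⟩ := Nat.exists_eq_add_of_le hi
  rw [hj, pow_add]
  exact Ideal.mul_mem_right _ _ (Ideal.mul_mem_right _ _ (X_pow_ten_mem_symbolIdeal i))

end Symbols

section LowDegree

theorem sum_piAntidiag_fin_three {M : Type*} [AddCommMonoid M] (k : ℕ) (f : (Fin 3 → ℕ) → M) :
    ∑ m ∈ Finset.piAntidiag (Finset.univ : Finset (Fin 3)) k, f m =
      ∑ i ∈ Finset.range (k + 1), ∑ j ∈ Finset.range (k + 1 - i), f ![i, j, k - i - j] := by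
  rw [Finset.sum_sigma']
  refine Finset.sum_nbij' (fun m => ⟨m 0, m 1⟩) (fun p => ![p.1, p.2, k - p.1 - p.2]) ?_ ?_ ?_ ?_ ?_
  · intro m hm
    simp [Fin.sum_univ_three] at hm ⊢
    omega
  · intro p hp
    simp [Fin.sum_univ_three] at hp ⊢
    omega
  · intro m hm
    simp [Fin.sum_univ_three] at hm
    funext i
    fin_cases i <;> simp
    omega
  · intro p _
    simp
  · intro m hm
    simp [Fin.sum_univ_three] at hm
    congr 1
    funext i
    fin_cases i <;> simp
    omega

theorem edgeMoment_rotate (r : ℝ) (i j l : ℕ) : edgeMoment r i j l = edgeMoment r j l i :=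
  (edgeMoment_swap_left r i j l).trans (edgeMoment_swap_right r j i l)

theorem halfPoly_eq_sum (r : ℝ) (k : ℕ) :
    halfPoly r k = ∑ i ∈ Finset.range (k + 1), ∑ j ∈ Finset.range (k + 1 - i),
      C (Nat.multinomial Finset.univ (2 • ![i, j, k - i - j]) *
        edgeMoment r (2 * i) (2 * j) (2 * (k - i - j))) *
          (X 0 ^ i * X 1 ^ j * X 2 ^ (k - i - j)) := by
  rw [halfPoly, sum_piAntidiag_fin_three]
  simp [Fin.prod_univ_three]

theorem halfPoly_one (r : ℝ) :
    halfPoly r 1 = C (edgeMoment r 2 0 0) * (X 0 + X 1 + X 2) := by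
  rw [halfPoly_eq_sum]
  simp [Finset.sum_range_succ, Nat.multinomial, Fin.sum_univ_three, Fin.prod_univ_three]
  rw [edgeMoment_rotate r 0 2 0, edgeMoment_rotate r 0 0 2, edgeMoment_rotate r 0 2 0]
  ring

theorem halfPoly_two (r : ℝ) :
    halfPoly r 2 = C (6 * edgeMoment r 2 2 0 - 2 * edgeMoment r 4 0 0) *
        (X 1 * X 2 + X 2 * X 0 + X 0 * X 1) +
      (X 0 + X 1 + X 2) * (C (edgeMoment r 4 0 0) * (X 0 + X 1 + X 2)) := by
  have h0 (n : ℕ) : edgeMoment r 0 n 0 = edgeMoment r n 0 0 := edgeMoment_rotate r 0 n 0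
  have h1 (n : ℕ) : edgeMoment r 0 0 n = edgeMoment r n 0 0 := (edgeMoment_rotate r n 0 0).symm
  have h2 : edgeMoment r 0 2 2 = edgeMoment r 2 2 0 := edgeMoment_rotate r 0 2 2
  have h3 : edgeMoment r 2 0 2 = edgeMoment r 2 2 0 := (edgeMoment_rotate r 2 2 0).symm
  rw [halfPoly_eq_sum]
  simp [Finset.sum_range_succ, Nat.multinomial, Fin.sum_univ_three, Fin.prod_univ_three,
    Nat.factorial, h0, h1, h2, h3]
  simp only [map_ofNat]
  ring

theorem halfPoly_three (r : ℝ) :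
    ∃ A, halfPoly r 3 = C (3 * edgeMoment r 6 0 0 - 45 * edgeMoment r 4 2 0 +
        90 * edgeMoment r 2 2 2) * (X 0 * X 1 * X 2) + (X 0 + X 1 + X 2) * A := by
  refine ⟨C (edgeMoment r 6 0 0) * ((X 0 + X 1 + X 2) ^ 2 -
      3 * (X 1 * X 2 + X 2 * X 0 + X 0 * X 1)) +
    15 * C (edgeMoment r 4 2 0) * (X 1 * X 2 + X 2 * X 0 + X 0 * X 1), ?_⟩
  have h0 (n : ℕ) : edgeMoment r 0 n 0 = edgeMoment r n 0 0 := edgeMoment_rotate r 0 n 0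
  have h1 (n : ℕ) : edgeMoment r 0 0 n = edgeMoment r n 0 0 := (edgeMoment_rotate r n 0 0).symm
  have h2 : edgeMoment r 2 0 4 = edgeMoment r 4 2 0 := (edgeMoment_rotate r 4 2 0).symm
  have h3 : edgeMoment r 0 4 2 = edgeMoment r 4 2 0 := edgeMoment_rotate r 0 4 2
  have h4 : edgeMoment r 2 4 0 = edgeMoment r 4 2 0 := edgeMoment_swap_left r 2 4 0
  have h5 : edgeMoment r 4 0 2 = edgeMoment r 4 2 0 := edgeMoment_swap_right r 4 0 2
  have h6 : edgeMoment r 0 2 4 = edgeMoment r 4 2 0 := (edgeMoment_rotate r 0 2 4).trans h4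
  rw [halfPoly_eq_sum]
  simp [Finset.sum_range_succ, Nat.multinomial, Fin.sum_univ_three, Fin.prod_univ_three,
    Nat.factorial, h0, h1, h2, h3, h4, h5, h6]
  simp only [map_ofNat]
  ring

theorem halfPoly_four (r : ℝ) :
    ∃ A, halfPoly r 4 = C (2 * edgeMoment r 8 0 0 - 56 * edgeMoment r 6 2 0 +
        70 * edgeMoment r 4 4 0) * (X 1 * X 2 + X 2 * X 0 + X 0 * X 1) ^ 2 +
      (X 0 + X 1 + X 2) * A := by
  refine ⟨C (edgeMoment r 8 0 0) * ((X 0 + X 1 + X 2) ^ 3 -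
      4 * (X 0 + X 1 + X 2) * (X 1 * X 2 + X 2 * X 0 + X 0 * X 1) + 4 * (X 0 * X 1 * X 2)) +
    28 * C (edgeMoment r 6 2 0) * ((X 0 + X 1 + X 2) * (X 1 * X 2 + X 2 * X 0 + X 0 * X 1) -
      X 0 * X 1 * X 2) - 140 * C (edgeMoment r 4 4 0) * (X 0 * X 1 * X 2) +
    420 * C (edgeMoment r 4 2 2) * (X 0 * X 1 * X 2), ?_⟩
  have h0 (n : ℕ) : edgeMoment r 0 n 0 = edgeMoment r n 0 0 := edgeMoment_rotate r 0 n 0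
  have h1 (n : ℕ) : edgeMoment r 0 0 n = edgeMoment r n 0 0 := (edgeMoment_rotate r n 0 0).symm
  have h2 : edgeMoment r 2 0 6 = edgeMoment r 6 2 0 := (edgeMoment_rotate r 6 2 0).symm
  have h3 : edgeMoment r 0 6 2 = edgeMoment r 6 2 0 := edgeMoment_rotate r 0 6 2
  have h4 : edgeMoment r 2 6 0 = edgeMoment r 6 2 0 := edgeMoment_swap_left r 2 6 0
  have h5 : edgeMoment r 6 0 2 = edgeMoment r 6 2 0 := edgeMoment_swap_right r 6 0 2
  have h6 : edgeMoment r 0 2 6 = edgeMoment r 6 2 0 := (edgeMoment_rotate r 0 2 6).trans h4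
  have h7 : edgeMoment r 0 4 4 = edgeMoment r 4 4 0 := edgeMoment_rotate r 0 4 4
  have h8 : edgeMoment r 4 0 4 = edgeMoment r 4 4 0 := (edgeMoment_rotate r 4 4 0).symm
  have h9 : edgeMoment r 2 4 2 = edgeMoment r 4 2 2 := edgeMoment_rotate r 2 4 2
  have h10 : edgeMoment r 2 2 4 = edgeMoment r 4 2 2 := (edgeMoment_rotate r 4 2 2).symm
  rw [halfPoly_eq_sum]
  simp [Finset.sum_range_succ, Nat.multinomial, Fin.sum_univ_three, Fin.prod_univ_three,
    Nat.factorial, h0, h1, h2, h3, h4, h5, h6, h7, h8, h9, h10]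
  simp only [map_ofNat]
  ring

end LowDegree

section Harmonics

open Filter Topology

theorem measureReal_edgeSet {r : ℝ} (hr : 0 < r) :
    ((μH[1] : Measure E3).restrict (edgeSet r)).real Set.univ = edgeMoment r 0 0 0 := by
  simpa using integral_edgeSet_monomial hr 0

theorem momentPoly_two {r : ℝ} (hr : 0 < r) :
    momentPoly ((μH[1] : Measure E3).restrict (edgeSet r)) 2 = C (edgeMoment r 2 0 0) * e2 := by
  have h := momentPoly_edgeSet_two_mul hr 1
  rw [halfPoly_one, mul_one] at h
  rw [h]
  simp [e2]

theorem momentPoly_four {r : ℝ} (hr : 0 < r) :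
    ∃ A, momentPoly ((μH[1] : Measure E3).restrict (edgeSet r)) 4 =
      C (6 * edgeMoment r 2 2 0 - 2 * edgeMoment r 4 0 0) * e4 + e2 * A := by
  have h := momentPoly_edgeSet_two_mul hr 2
  rw [halfPoly_two] at h
  refine ⟨expand 2 (C (edgeMoment r 4 0 0) * (X 0 + X 1 + X 2)), h.trans ?_⟩
  rw [map_add, map_mul, map_mul _ (X 0 + X 1 + X 2), expand_C]
  simp only [e4, e2, map_add, map_mul, expand_X]

theorem momentPoly_six {r : ℝ} (hr : 0 < r) :
    ∃ A, momentPoly ((μH[1] : Measure E3).restrict (edgeSet r)) 6 =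
      C (3 * edgeMoment r 6 0 0 - 45 * edgeMoment r 4 2 0 + 90 * edgeMoment r 2 2 2) * e6 +
        e2 * A := by
  have h := momentPoly_edgeSet_two_mul hr 3
  obtain ⟨A, hA⟩ := halfPoly_three r
  rw [hA] at h
  refine ⟨expand 2 A, h.trans ?_⟩
  rw [map_add, map_mul, map_mul _ (X 0 + X 1 + X 2), expand_C]
  simp only [e6, e2, map_add, map_mul, expand_X]

theorem momentPoly_eight {r : ℝ} (hr : 0 < r) :
    ∃ A, momentPoly ((μH[1] : Measure E3).restrict (edgeSet r)) 8 =
      C (2 * edgeMoment r 8 0 0 - 56 * edgeMoment r 6 2 0 + 70 * edgeMoment r 4 4 0) * e4 ^ 2 +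
        e2 * A := by
  have h := momentPoly_edgeSet_two_mul hr 4
  obtain ⟨A, hA⟩ := halfPoly_four r
  rw [hA] at h
  refine ⟨expand 2 A, h.trans ?_⟩
  rw [map_add, map_mul, map_mul _ (X 0 + X 1 + X 2), expand_C]
  simp only [e4, e2, map_add, map_mul, map_pow, expand_X]

theorem mem_of_C_mul_add_mem {I : Ideal (MvPolynomial (Fin 3) ℝ)} {a : ℝ} (ha : a ≠ 0)
    {e A : MvPolynomial (Fin 3) ℝ} (h2 : e2 ∈ I) (h : C a * e + e2 * A ∈ I) : e ∈ I := by
  have h1 : C a * e ∈ I := (I.add_mem_iff_left (I.mul_mem_right _ h2)).1 h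
  have h3 := I.mul_mem_left (C a⁻¹) h1
  rwa [← mul_assoc, ← C_mul, inv_mul_cancel₀ ha, C_1, one_mul] at h3

theorem symbolIdeal_le {I : Ideal (MvPolynomial (Fin 3) ℝ)} (h2 : e2 ∈ I) (h6 : e6 ∈ I)
    (h4 : e4 ^ 2 ∈ I) : symbolIdeal ≤ I := by
  rw [symbolIdeal, Ideal.span_le]
  rintro φ (rfl | rfl | rfl)
  exacts [h2, h6, h4]

theorem e2_mem_of_momentPoly_mem {r : ℝ} (hr : 0 < r) {I : Ideal (MvPolynomial (Fin 3) ℝ)}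
    (hI : ∀ k, k ≠ 0 → momentPoly ((μH[1] : Measure E3).restrict (edgeSet r)) k ∈ I) :
    e2 ∈ I := by
  have h := hI 2 two_ne_zero
  rw [momentPoly_two hr] at h
  have h3 := I.mul_mem_left (C (edgeMoment r 2 0 0)⁻¹) h
  rwa [← mul_assoc, ← C_mul, inv_mul_cancel₀ (edgeMoment_two_pos hr).ne', C_1, one_mul] at h3

theorem symbolIdeal_le_of_momentPoly_mem {r : ℝ} (hr : 0 < r)
    {I : Ideal (MvPolynomial (Fin 3) ℝ)}
    (hI : ∀ k, k ≠ 0 → momentPoly ((μH[1] : Measure E3).restrict (edgeSet r)) k ∈ I) :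
    symbolIdeal ≤ I := by
  have h2 := e2_mem_of_momentPoly_mem hr hI
  obtain ⟨A, hA⟩ := momentPoly_six hr
  obtain ⟨B, hB⟩ := momentPoly_eight hr
  exact symbolIdeal_le h2
    (mem_of_C_mul_add_mem (edgeMoment_six_pos hr).ne' h2 (hA ▸ hI 6 (by decide)))
    (mem_of_C_mul_add_mem (edgeMoment_eight_pos hr).ne' h2 (hB ▸ hI 8 (by decide)))

theorem exists_linForm_pow_mem_symbolIdeal : ∃ N, ∀ y, linForm y ^ N ∈ symbolIdeal :=
  ⟨28, linForm_pow_mem_symbolIdeal⟩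

theorem exists_eval_of_integral_eq {r : ℝ} (hr : 0 < r) {f : E3 → ℝ} (hf : Continuous f)
    (hm : ∀ x (s : ℝ), 0 < s → f x * ((μH[1] : Measure E3).restrict (edgeSet r)).real Set.univ =
      ∫ y in edgeSet r, f (x + s • y) ∂(μH[1])) :
    ∃ p : MvPolynomial (Fin 3) ℝ, (∀ x, f x = eval (toFn x) p) ∧
      ∀ k, k ≠ 0 → momentPoly ((μH[1] : Measure E3).restrict (edgeSet r)) k ∈
        annIdeal partialD partialD_commute (evalSmooth p) := by
  have := isFiniteMeasure_edgeSet hr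
  obtain ⟨R, hR⟩ := exists_norm_le_edgeSet r
  obtain ⟨g, hg, hlim⟩ := exists_smooth_approx hR hf hm
  obtain ⟨N, hN⟩ := exists_linForm_pow_mem_symbolIdeal
  have hpoly : ∀ n, (g n).1 ∈ polyFn N := fun n => by
    refine mem_polyFn_of_diffOp_eq_zero fun y => ?_
    have hI : symbolIdeal ≤ annIdeal partialD partialD_commute (g n) :=
      symbolIdeal_le_of_momentPoly_mem hr fun k hk =>
        mem_annIdeal.2 (diffOp_momentPoly_eq_zero hR (hg n) hk)
    exact mem_annIdeal.1 (hI (hN y))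
  have hfp : f ∈ polyFn N := (isClosed_polyFn N).mem_of_tendsto
    (tendsto_pi_nhds.2 hlim) (Eventually.of_forall hpoly)
  obtain ⟨p, hp⟩ := exists_eval_of_mem_polyFn hfp
  have hfp' : f = (evalSmooth p).1 := funext hp
  refine ⟨p, hp, fun k hk => mem_annIdeal.2 (diffOp_momentPoly_eq_zero hR ?_ hk)⟩
  rw [← hfp']
  exact hm

theorem integral_eq_of_momentPoly_mem {r : ℝ} (hr : 0 < r) {p : MvPolynomial (Fin 3) ℝ}
    (h2 : dop e2 p = 0) (h6 : dop e6 p = 0) (h44 : dop (e4 ^ 2) p = 0)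
    (h4 : C (6 * edgeMoment r 2 2 0 - 2 * edgeMoment r 4 0 0) * e4 ∈
      annIdeal partialD partialD_commute (evalSmooth p)) (x : E3) (s : ℝ) :
    ∫ y in edgeSet r, eval (toFn (x + s • y)) p ∂(μH[1]) =
      eval (toFn x) p * ((μH[1] : Measure E3).restrict (edgeSet r)).real Set.univ := by
  have := isFiniteMeasure_edgeSet hr
  obtain ⟨R, hR⟩ := exists_norm_le_edgeSet r
  rw [dop_eq_zero_iff] at h2 h6 h44
  have hI := symbolIdeal_le h2 h6 h44
  obtain ⟨N, hN⟩ := exists_linForm_pow_mem_symbolIdeal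
  refine integral_eq_of_diffOp_momentPoly_eq_zero hR (g := evalSmooth p) (N := N)
    (fun y => mem_annIdeal.1 (hI (hN y)))
    (fun k hk => mem_annIdeal.1 ?_) x s
  by_cases hk4 : k = 4
  · obtain ⟨A, hA⟩ := momentPoly_four hr
    rw [hk4, hA]
    exact add_mem h4 (Ideal.mul_mem_right _ _ h2)
  · exact hI (momentPoly_mem_symbolIdeal hr hk hk4)

theorem dop_sq (φ p : MvPolynomial (Fin 3) ℝ) : dop (φ ^ 2) p = dop φ (dop φ p) := by
  rw [dop_eq_act, dop_eq_act, pow_two, map_mul, Module.End.mul_apply]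

end Harmonics

theorem triakisOctahedron_edge_harmonics
    (r : ℝ) (hr : 0 < r)
    (r₁ : ℝ) (hr₁pos : 0 < r₁)
    (hr₁root : 16 * r₁ ^ 8 + 32 * r₁ ^ 7 + 40 * r₁ ^ 6 - 48 * r₁ ^ 5 - 396 * r₁ ^ 4 -
      432 * r₁ ^ 3 - 810 * r₁ ^ 2 - 972 * r₁ - 729 = 0)
    (hr₁uniq : ∀ y : ℝ, 0 < y →
      16 * y ^ 8 + 32 * y ^ 7 + 40 * y ^ 6 - 48 * y ^ 5 - 396 * y ^ 4 -
        432 * y ^ 3 - 810 * y ^ 2 - 972 * y - 729 = 0 → y = r₁)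
    (f : E3 → ℝ) (hf : Continuous f) :
    (∀ (x : E3) (s : ℝ), 0 < s →
        f x = (∫ y in edgeSet r, f (x + s • y) ∂(μH[1])) / (μH[1] (edgeSet r)).toReal) ↔
      ((r = r₁ → ∃ p : MvPolynomial (Fin 3) ℝ,
          dop e2 p = 0 ∧ dop e6 p = 0 ∧ dop e4 (dop e4 p) = 0 ∧ ∀ x, f x = eval (toFn x) p) ∧
       (r ≠ r₁ → ∃ p : MvPolynomial (Fin 3) ℝ,
          dop e2 p = 0 ∧ dop e4 p = 0 ∧ dop e6 p = 0 ∧ ∀ x, f x = eval (toFn x) p)) := by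
  have hν := measureReal_edgeSet hr
  have hpos := edgeMoment_zero_pos r
  have hμ : (μH[1] (edgeSet r)).toReal = edgeMoment r 0 0 0 := by
    rw [← hν, measureReal_def, Measure.restrict_apply_univ]
  have h4iff := edgeMoment_four_eq_zero_iff hr r₁ hr₁pos hr₁root hr₁uniq
  simp only [hμ, eq_div_iff hpos.ne']
  constructor
  · intro hm
    obtain ⟨p, hp, hI⟩ := exists_eval_of_integral_eq hr hf (by rwa [hν])
    have hS := symbolIdeal_le_of_momentPoly_mem hr hI
    have h2 := (dop_eq_zero_iff _ _).2 (hS e2_mem_symbolIdeal)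
    have h6 := (dop_eq_zero_iff _ _).2 (hS e6_mem_symbolIdeal)
    refine ⟨fun _ => ⟨p, h2, h6, ?_, hp⟩, fun hne => ⟨p, h2, ?_, h6, hp⟩⟩
    · rw [← dop_sq]
      exact (dop_eq_zero_iff _ _).2 (hS e4_sq_mem_symbolIdeal)
    · obtain ⟨A, hA⟩ := momentPoly_four hr
      exact (dop_eq_zero_iff _ _).2 (mem_of_C_mul_add_mem (h4iff.not.2 hne)
        (hS e2_mem_symbolIdeal) (hA ▸ hI 4 (by decide)))
  · rintro ⟨heq, hne⟩ x s -
    by_cases hrr : r = r₁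
    · obtain ⟨p, h2, h6, h44, hp⟩ := heq hrr
      simp only [hp]
      rw [← hν]
      refine (integral_eq_of_momentPoly_mem hr h2 h6 (by rwa [dop_sq]) ?_ x s).symm
      rw [h4iff.2 hrr, C_0, zero_mul]
      exact zero_mem _
    · obtain ⟨p, h2, h4, h6, hp⟩ := hne hrr
      simp only [hp]
      rw [← hν]
      exact (integral_eq_of_momentPoly_mem hr h2 h6 (by rw [dop_sq, h4, map_zero])
        (Ideal.mul_mem_left _ _ ((dop_eq_zero_iff _ _).1 h4)) x s).symm
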